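/- Let V be a vector space over a field F, and let A₁, A₂, A₃ be subspaces that are independent: A_i ⊓ (A_j ⊔ A_k) = ⊥ for every permutation (i,j,k) of (1,2,3). For linear maps h : A_i → A_j, write Γ_{ij}(h) := { v - h(v) : v ∈ A_i }. Then for all linear maps f : A₁ → A₂ and g : A₂ → A₃: Γ₁₃(g ∘ f) = (Γ₁₂(f) ⊔ Γ₂₃(g)) ⊓ (A₁ ⊔ A₃). -/

import Mathlib

/-- The (negative) graph `Γ_{ij}(h) = { v - h v : v ∈ A_i }` of a linear map `h : A_i → A_j`
between submodules of `V`, as a submodule of `V`. -/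
def graphSub {F V : Type*} [Field F] [AddCommGroup V] [Module F V]
    (A B : Submodule F V) (h : A →ₗ[F] B) : Submodule F V :=
  LinearMap.range (A.subtype - B.subtype ∘ₗ h)

theorem stmt_6 {F V : Type*} [Field F] [AddCommGroup V] [Module F V]
    (A1 A2 A3 : Submodule F V)
    (h1 : A1 ⊓ (A2 ⊔ A3) = ⊥) (h2 : A2 ⊓ (A1 ⊔ A3) = ⊥) (h3 : A3 ⊓ (A1 ⊔ A2) = ⊥)
    (f : A1 →ₗ[F] A2) (g : A2 →ₗ[F] A3) :
    graphSub A1 A3 (g ∘ₗ f) = (graphSub A1 A2 f ⊔ graphSub A2 A3 g) ⊓ (A1 ⊔ A3) := by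
  ext v
  constructor
  · rintro ⟨x, rfl⟩
    refine ⟨Submodule.mem_sup.2 ⟨_, ⟨x, rfl⟩, _, ⟨f x, rfl⟩, ?_⟩, ?_⟩
    · simp
    · exact Submodule.sub_mem _ (Submodule.mem_sup_left x.2)
        (Submodule.mem_sup_right (g (f x)).2)
  · rintro ⟨hv, hw⟩
    obtain ⟨_, ⟨x, rfl⟩, _, ⟨y, rfl⟩, rfl⟩ := Submodule.mem_sup.1 hv
    have hy : (y : V) - f x ∈ A2 ⊓ (A1 ⊔ A3) := by
      refine ⟨Submodule.sub_mem _ y.2 (f x).2, ?_⟩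
      change (y : V) - f x ∈ A1 ⊔ A3
      have h := Submodule.add_mem _ (Submodule.sub_mem _ hw
        (Submodule.mem_sup_left x.2 : (x : V) ∈ A1 ⊔ A3))
        (Submodule.mem_sup_right (g y).2 : (g y : V) ∈ A1 ⊔ A3)
      convert h using 1
      simp only [LinearMap.sub_apply, LinearMap.comp_apply, Submodule.subtype_apply]
      abel
    rw [h2, Submodule.mem_bot, sub_eq_zero] at hy
    have hy' : y = f x := Subtype.ext hy
    subst hy'
    exact ⟨x, by simp⟩
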